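/- Let X, Y be Hilbert spaces, T : X → Y a bounded linear operator, A a nonempty index set, and {R_α}_{α∈A} any family of bounded linear operators from Y to X. If x ∈ X, x ≠ 0, and δ > 0, then inf_{α∈A} sup{‖R_α y − x‖ : y ∈ Y, ‖Tx − y‖ ≤ δ} > 0. (In particular, the total error of any regularization family at a nonzero element is strictly positive for every positive noise level; equivalently, if the total error vanishes at some x and some δ > 0, then x = 0.) -/

import Mathlib

open Filter Topology Set Asymptotics

noncomputable section

/-- `ρ ∈ 𝒪`: non-decreasing, positive on `(0,∞)`, with `ρ(α) → 0` as `α → 0⁺`. -/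
def MemO (ρ : ℝ → ℝ) : Prop :=
  (∀ α > (0:ℝ), 0 < ρ α) ∧ (∀ a b : ℝ, 0 < a → a ≤ b → ρ a ≤ ρ b) ∧
    Tendsto ρ (𝓝[>] (0:ℝ)) (𝓝 0)

/-- `s ∈ 𝒮`: continuous on `[0,∞)`, `s 0 = 0`, nonnegative, positive on `(0,∞)`. -/
def MemS (s : ℝ → ℝ) : Prop :=
  ContinuousOn s (Ici (0:ℝ)) ∧ s 0 = 0 ∧ (∀ t, 0 ≤ t → 0 ≤ s t) ∧ (∀ t, 0 < t → 0 < s t)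

/-- Spectral regularization method on `[0,Λ]` (hypotheses H2, H3). -/
def IsSRM (α₀ Λ : ℝ) (g : ℝ → ℝ → ℝ) : Prop :=
  (∃ C > (0:ℝ), ∀ α ∈ Ioo (0:ℝ) α₀, ∀ lam ∈ Icc (0:ℝ) Λ, |lam * g α lam| ≤ C) ∧
  (∀ lam ∈ Ioc (0:ℝ) Λ, Tendsto (fun α => g α lam) (𝓝[>] (0:ℝ)) (𝓝 (1 / lam)))

/-- `(s,ρ)` is a weak source-order pair: `limsup_{α→0⁺} s(λ)|r_α(λ)|/ρ(α) < ∞` for `λ ∈ (0,Λ]`. -/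
def WeakSourceOrderPair (Λ : ℝ) (g : ℝ → ℝ → ℝ) (s ρ : ℝ → ℝ) : Prop :=
  ∀ lam ∈ Ioc (0:ℝ) Λ,
    Filter.limsup (fun α => ((s lam * |1 - lam * g α lam| / ρ α : ℝ) : EReal)) (𝓝[>] (0:ℝ)) < ⊤

/-- `(s,ρ)` is a strong source-order pair: weak, and the `limsup` is `> 0` for every `λ ∈ (0,Λ]`. -/
def StrongSourceOrderPair (Λ : ℝ) (g : ℝ → ℝ → ℝ) (s ρ : ℝ → ℝ) : Prop :=
  WeakSourceOrderPair Λ g s ρ ∧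
  ∀ lam ∈ Ioc (0:ℝ) Λ,
    0 < Filter.limsup (fun α => ((s lam * |1 - lam * g α lam| / ρ α : ℝ) : EReal)) (𝓝[>] (0:ℝ))

/-- `(ρ,s)` is an order-source pair: `∃ γ > 0` and `h → 0` with
`s(λ)|r_α(λ)| ≥ γ ρ(α)` for all `α ∈ (0,α₀)` and `λ ∈ [h(α),Λ]`. -/
def OrderSourcePair (α₀ Λ : ℝ) (g : ℝ → ℝ → ℝ) (ρ s : ℝ → ℝ) : Prop :=
  ∃ γ > (0:ℝ), ∃ h : ℝ → ℝ, (∀ α ∈ Ioo (0:ℝ) α₀, 0 < h α) ∧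
    Tendsto h (𝓝[>] (0:ℝ)) (𝓝 0) ∧
    ∀ α ∈ Ioo (0:ℝ) α₀, ∀ lam ∈ Icc (h α) Λ, γ * ρ α ≤ s lam * |1 - lam * g α lam|

/-- `ρ` is an optimal qualification of `{g_α}`. -/
def OptimalQualification (α₀ Λ : ℝ) (g : ℝ → ℝ → ℝ) (ρ : ℝ → ℝ) : Prop :=
  ∃ s : ℝ → ℝ, MemS s ∧ StrongSourceOrderPair Λ g s ρ ∧ OrderSourcePair α₀ Λ g ρ s

variable {X Y : Type*} [NormedAddCommGroup X] [InnerProductSpace ℂ X] [CompleteSpace X]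
  [NormedAddCommGroup Y] [InnerProductSpace ℂ Y] [CompleteSpace Y]

/-- The spectral regularization operators `R_α = g_α(T*T) T*`. -/
noncomputable def Rop (g : ℝ → ℝ → ℝ) (T : X →L[ℂ] Y) (α : ℝ) : Y →L[ℂ] X :=
  (cfc (g α) ((ContinuousLinearMap.adjoint T).comp T)).comp (ContinuousLinearMap.adjoint T)

/-- The total error `e(x,δ) = inf_{α∈(0,α₀)} sup_{‖Tx-y‖≤δ} ‖R_α y - x‖`. -/
noncomputable def totErr (α₀ : ℝ) (T : X →L[ℂ] Y) (R : ℝ → Y →L[ℂ] X) (x : X) (δ : ℝ) : ℝ :=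
  ⨅ α : Ioo (0:ℝ) α₀, ⨆ y : {y : Y // ‖T x - y‖ ≤ δ}, ‖R α.1 y.1 - x‖

/-- The data errors `‖R y - x‖` over a closed ball of data are bounded. -/
lemma bddAbove_range_norm_apply_sub (S : Y →L[ℂ] X) (x : X) (z : Y) (δ : ℝ) :
    BddAbove (range fun y : {y : Y // ‖z - y‖ ≤ δ} => ‖S y.1 - x‖) := by
  refine ⟨‖S‖ * (‖z‖ + δ) + ‖x‖, ?_⟩
  rintro _ ⟨⟨y, hy⟩, rfl⟩
  have hy' : ‖y‖ ≤ ‖z‖ + δ := (norm_le_norm_add_norm_sub z y).trans (by gcongr)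
  calc ‖S y - x‖ ≤ ‖S y‖ + ‖x‖ := norm_sub_le _ _
    _ ≤ ‖S‖ * (‖z‖ + δ) + ‖x‖ := by gcongr; exact S.le_opNorm_of_le hy'

/-- A linear reconstruction cannot recover `x` from both `z` and `(1 + t) z`. -/
lemma mul_norm_le_of_norm_apply_sub_le (S : Y →L[ℂ] X) (x : X) (z : Y) {t M : ℝ} (ht : 0 ≤ t)
    (h₁ : ‖S z - x‖ ≤ M) (h₂ : ‖S (((1 + t : ℝ) : ℂ) • z) - x‖ ≤ M) :
    t * ‖x‖ ≤ (2 + t) * M := by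
  have key : (t : ℂ) • x =
      (S (((1 + t : ℝ) : ℂ) • z) - x) - ((1 + t : ℝ) : ℂ) • (S z - x) := by
    rw [map_smul]
    push_cast
    module
  calc t * ‖x‖ = ‖(t : ℂ) • x‖ := by
        rw [norm_smul, Complex.norm_of_nonneg ht]
    _ ≤ ‖S (((1 + t : ℝ) : ℂ) • z) - x‖ + ‖((1 + t : ℝ) : ℂ) • (S z - x)‖ := by
        rw [key]; exact norm_sub_le _ _
    _ = ‖S (((1 + t : ℝ) : ℂ) • z) - x‖ + (1 + t) * ‖S z - x‖ := by
        rw [norm_smul, Complex.norm_of_nonneg (by positivity)]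
    _ ≤ M + (1 + t) * M := by gcongr
    _ = (2 + t) * M := by ring

/-- for any family of bounded operators `{R_α}_{α∈A}` (`A` nonempty), any
`x ≠ 0` and any `δ > 0`, the total error `inf_α sup_{‖Tx-y‖≤δ} ‖R_α y - x‖` is positive. -/
theorem stmt11 (T : X →L[ℂ] Y) (A : Type*) [Nonempty A] (R : A → Y →L[ℂ] X)
    (x : X) (hx : x ≠ 0) (δ : ℝ) (hδ : 0 < δ) :
    0 < ⨅ α : A, ⨆ y : {y : Y // ‖T x - y‖ ≤ δ}, ‖R α y.1 - x‖ := by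
  set t : ℝ := δ / (‖T x‖ + 1) with ht_def
  have ht : 0 < t := by positivity
  have hpos : 0 < t * ‖x‖ / (2 + t) := by
    have := norm_pos_iff.mpr hx
    positivity
  refine hpos.trans_le (le_ciInf fun α => ?_)
  have hbdd := bddAbove_range_norm_apply_sub (R α) x (T x) δ
  have hmem : ‖T x - ((1 + t : ℝ) : ℂ) • T x‖ ≤ δ := by
    have hsub : T x - ((1 + t : ℝ) : ℂ) • T x = -((t : ℂ) • T x) := by
      push_cast
      module
    rw [hsub, norm_neg, norm_smul, Complex.norm_of_nonneg ht.le]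
    calc t * ‖T x‖ ≤ t * (‖T x‖ + 1) := by gcongr; linarith
      _ = δ := div_mul_cancel₀ _ (by positivity)
  rw [div_le_iff₀' (by positivity)]
  exact mul_norm_le_of_norm_apply_sub_le (R α) x (T x) ht.le
    (le_ciSup hbdd ⟨T x, by simpa using hδ.le⟩) (le_ciSup hbdd ⟨_, hmem⟩)
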